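/- Let F be an algebraically closed field with char F ≠ 2, let L = sl_2(F), and let G be an abelian group. For every G-grading L = ⊕_{g∈G} L_g of the Lie algebra L, exactly one of the following holds: (i) there exist an element g ∈ G and a basis (E, H, F') of sl_2(F) satisfying [H,E] = 2E, [H,F'] = −2F', [E,F'] = H, such that H ∈ L_e, E ∈ L_g and F' ∈ L_{g⁻¹} (the grading is induced from a Cartan decomposition); or (ii) there is a subgroup T of G isomorphic to Z/2Z × Z/2Z such that L_g ≠ 0 exactly for the three nontrivial elements g of T, and each such component L_g is one-dimensional (a Pauli grading). -/

import Mathlib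

/-- The Lie algebra `sl_n(F)` of traceless matrices, as a subspace of `Mₙ(F)`. -/
def slM (F : Type*) [Field F] (n : ℕ) : Submodule F (Matrix (Fin n) (Fin n) F) :=
  LinearMap.ker (Matrix.traceLinearMap (Fin n) F F)

section
variable {F : Type*} [Field F] {x y H : Matrix (Fin 2) (Fin 2) F}

theorem mem_slM_two_iff : x ∈ slM F 2 ↔ x 1 1 = -x 0 0 := by
  rw [slM, LinearMap.mem_ker, Matrix.traceLinearMap_apply, Matrix.trace_fin_two, add_comm,
    add_eq_zero_iff_eq_neg]

/-- The anticommutator of two traceless `2 × 2` matrices is scalar. -/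
theorem slM_two_mul_add_mul (hx : x ∈ slM F 2) (hy : y ∈ slM F 2) :
    x * y + y * x = (x * y).trace • (1 : Matrix (Fin 2) (Fin 2) F) := by
  rw [mem_slM_two_iff] at hx hy
  ext i j
  fin_cases i <;> fin_cases j <;>
    simp [Matrix.mul_apply, Fin.sum_univ_two, Matrix.trace_fin_two, hx, hy] <;> ring

theorem slM_two_lie_lie (hx : x ∈ slM F 2) (hy : y ∈ slM F 2) :
    x * (x * y - y * x) - (x * y - y * x) * x
      = (2 * (x * x).trace) • y - (2 * (x * y).trace) • x := by
  rw [mem_slM_two_iff] at hx hy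
  ext i j
  fin_cases i <;> fin_cases j <;>
    simp [Matrix.mul_apply, Fin.sum_univ_two, Matrix.trace_fin_two, hx, hy] <;> ring

theorem single_zero_one_mem_slM : (!![0, 1; 0, 0] : Matrix (Fin 2) (Fin 2) F) ∈ slM F 2 := by
  simp [mem_slM_two_iff]

theorem single_one_zero_mem_slM : (!![0, 0; 1, 0] : Matrix (Fin 2) (Fin 2) F) ∈ slM F 2 := by
  simp [mem_slM_two_iff]

theorem single_sub_single_mem_slM : (!![1, 0; 0, -1] : Matrix (Fin 2) (Fin 2) F) ∈ slM F 2 := by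
  simp [mem_slM_two_iff]

/-- The trace form on `sl₂` is nondegenerate. -/
theorem eq_zero_of_trace_mul_slM (h2 : (2 : F) ≠ 0) (hx : x ∈ slM F 2)
    (h : ∀ y ∈ slM F 2, (x * y).trace = 0) : x = 0 := by
  have h₁ := h _ single_zero_one_mem_slM
  have h₃ := h _ single_one_zero_mem_slM
  have h₄ := h _ single_sub_single_mem_slM
  rw [mem_slM_two_iff] at hx
  simp [Matrix.mul_apply, Fin.sum_univ_two, Matrix.trace_fin_two, hx] at h₁ h₃ h₄
  have h₅ : x 0 0 = 0 := by
    have : 2 * x 0 0 = 0 := by linear_combination h₄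
    simpa [h2] using this
  ext i j
  fin_cases i <;> fin_cases j <;> simp [*]

/-- The center of `sl₂` is trivial. -/
theorem eq_zero_of_commute_slM (h2 : (2 : F) ≠ 0) (hx : x ∈ slM F 2)
    (h : ∀ y ∈ slM F 2, x * y - y * x = 0) : x = 0 := by
  have h₁ := h _ single_zero_one_mem_slM
  have h₃ := h _ single_one_zero_mem_slM
  rw [mem_slM_two_iff] at hx
  have h₅ : x 0 0 = 0 := by
    have h₆ := congrFun (congrFun h₁ 0) 1
    simp [Matrix.mul_apply, Fin.sum_univ_two, Matrix.vecMul, dotProduct, hx] at h₆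
    have : 2 * x 0 0 = 0 := by linear_combination h₆
    simpa [h2] using this
  have h₆ := congrFun (congrFun h₁ 0) 0
  have h₇ := congrFun (congrFun h₃ 0) 0
  simp [Matrix.mul_apply, Fin.sum_univ_two, Matrix.vecMul, dotProduct] at h₆ h₇
  ext i j
  fin_cases i <;> fin_cases j <;> simp [*]

theorem exists_mul_mul_ne_zero (h2 : (2 : F) ≠ 0) (hH : H ∈ slM F 2) :
    ∃ y ∈ slM F 2, (1 + H) * y * (1 - H) ≠ 0 := by
  by_contra! h
  have h₁ := congrFun (congrFun (h _ single_zero_one_mem_slM) 0) 1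
  have h₃ := congrFun (congrFun (h _ single_one_zero_mem_slM) 1) 0
  rw [mem_slM_two_iff] at hH
  simp [Matrix.mul_apply, Fin.sum_univ_two, hH] at h₁ h₃
  replace h₃ : 1 - H 0 0 = 0 := h₃.elim (fun h => by linear_combination h) id
  exact h2 (by linear_combination h₁ + h₃)

theorem finrank_slM_two : Module.finrank F (slM F 2) = 3 := by
  have hs : LinearMap.range (Matrix.traceLinearMap (Fin 2) F F) = ⊤ :=
    LinearMap.range_eq_top.mpr fun a => ⟨!![a, 0; 0, 0], by simp [Matrix.trace_fin_two]⟩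
  have := LinearMap.finrank_range_add_finrank_ker (Matrix.traceLinearMap (Fin 2) F F)
  rw [hs, finrank_top, Module.finrank_self, Module.finrank_matrix] at this
  simp at this
  rw [slM]
  omega
theorem trace_eq_zero_of_mem_slM {n : ℕ} {x : Matrix (Fin n) (Fin n) F} (hx : x ∈ slM F n) :
    x.trace = 0 := hx

theorem sl2_triple_of_eigenvectors (h2 : (2 : F) ≠ 0) {E H F' : Matrix (Fin 2) (Fin 2) F}
    (hE : E ∈ slM F 2) (hH : H ∈ slM F 2) (hF : F' ∈ slM F 2) (hHH : H * H = 1)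
    (hHE : H * E = E) (hEH : E * H = -E) (hHF : H * F' = -F') (hFH : F' * H = F')
    (hEF : (E * F').trace = 1) :
    LinearIndependent F ![E, H, F'] ∧
      Submodule.span F {E, H, F'} = slM F 2 ∧
      H * E - E * H = (2 : F) • E ∧
      H * F' - F' * H = -((2 : F) • F') ∧
      E * F' - F' * E = H := by
  have hE0 : E ≠ 0 := by rintro rfl; simp at hEF
  have hF0 : F' ≠ 0 := by rintro rfl; simp at hEF
  have hli : LinearIndependent F ![E, H, F'] := by
    rw [Fintype.linearIndependent_iff]
    intro c hc
    simp only [Fin.sum_univ_three, Matrix.cons_val_zero, Matrix.cons_val_one, Matrix.cons_val] at hc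
    have hc' : c 0 • E + c 1 • (1 : Matrix (Fin 2) (Fin 2) F) - c 2 • F' = 0 := by
      have := congrArg (H * ·) hc
      simpa [mul_add, hHE, hHH, hHF, sub_eq_add_neg] using this
    have h₁ : c 1 = 0 := by
      have := congrArg Matrix.trace hc'
      simpa [trace_eq_zero_of_mem_slM hE, trace_eq_zero_of_mem_slM hF, h2] using this
    rw [h₁, zero_smul, add_zero] at hc hc'
    have h₀ : c 0 = 0 := by
      have : (2 * c 0) • E = 0 := by
        calc (2 * c 0) • E = (c 0 • E + c 2 • F') + (c 0 • E - c 2 • F') := by module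
          _ = 0 := by rw [hc, hc', add_zero]
      simpa [h2, hE0] using this
    have h₃ : c 2 = 0 := by simpa [h₀, hF0] using hc
    intro i
    fin_cases i <;> assumption
  refine ⟨hli, ?_, ?_, ?_, ?_⟩
  · have hr : ({E, H, F'} : Set (Matrix (Fin 2) (Fin 2) F)) = Set.range ![E, H, F'] := by
      simp only [Matrix.range_cons, Matrix.range_empty, Set.union_empty, Set.singleton_union]
    rw [hr]
    refine Submodule.eq_of_le_of_finrank_eq ?_ ?_
    · rw [← hr, Submodule.span_le]
      rintro _ (rfl | rfl | rfl) <;> assumption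
    · rw [finrank_span_eq_card hli, finrank_slM_two, Fintype.card_fin]
  · rw [hHE, hEH, sub_neg_eq_add, two_smul]
  · rw [hHF, hFH, two_smul]; abel
  · have h := slM_two_mul_add_mul hE hF
    rw [hEF, one_smul] at h
    have hW : H * (E * F' - F' * E) = 1 := by
      rw [mul_sub, ← mul_assoc, ← mul_assoc, hHE, hHF, neg_mul, sub_neg_eq_add, h]
    rw [← one_mul (E * F' - F' * E), ← hHH, mul_assoc, hW, mul_one]

end

theorem Subgroup.exists_isKleinFour {G : Type*} [CommGroup G] {g h : G} (hg : g * g = 1)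
    (hh : h * h = 1) (hg1 : g ≠ 1) (hh1 : h ≠ 1) (hgh : g ≠ h) :
    ∃ T : Subgroup G, IsKleinFour T ∧ ∀ k, k ∈ T ↔ k = 1 ∨ k = g ∨ k = h ∨ k = g * h := by
  have hgl (a : G) : g * (g * a) = a := by rw [← mul_assoc, hg, one_mul]
  have hmul : g * h ≠ 1 := fun H => hgh (by rw [← mul_one g, ← hh, ← mul_assoc, H, one_mul])
  let T : Subgroup G :=
    { carrier := {k | k = 1 ∨ k = g ∨ k = h ∨ k = g * h}
      one_mem' := by simp
      mul_mem' := by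
        rintro a b (ha | ha | ha | ha) (hb | hb | hb | hb) <;>
          simp [ha, hb, hg, hh, hgl, mul_assoc, mul_comm h g, mul_left_comm h g]
      inv_mem' := by
        rintro a (ha | ha | ha | ha) <;>
          simp [ha, inv_eq_of_mul_eq_one_left hg, inv_eq_of_mul_eq_one_left hh, mul_comm h g] }
  have hT (k : G) : k ∈ T ↔ k = 1 ∨ k = g ∨ k = h ∨ k = g * h := Iff.rfl
  have hcard : Nat.card T = 4 := by
    change ({1, g, h, g * h} : Set G).ncard = 4
    rw [Set.ncard_insert_of_notMem, Set.ncard_insert_of_notMem, Set.ncard_pair] <;>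
      simp [hg1.symm, hh1.symm, hmul.symm, hgh, hg1, hh1]
  refine ⟨T, ⟨hcard, ?_⟩, hT⟩
  have : Nontrivial T := ⟨⟨g, by simp [hT]⟩, 1, by simpa [Subtype.ext_iff] using hg1⟩
  rw [Monoid.exponent_eq_prime_iff Nat.prime_two]
  rintro ⟨a, ha⟩ ha1
  refine orderOf_eq_prime ?_ ha1
  rw [Subtype.ext_iff]
  rw [hT] at ha
  rcases ha with ha | ha | ha | ha <;>
    simp [ha, pow_two, hg, hh, hgl, mul_assoc, mul_left_comm h g]

/-- `ℒ` is a grading of the Lie algebra `sl₂(F)` by the group `G`. -/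
structure IsSlTwoGrading {F G : Type*} [Field F] [CommGroup G]
    (ℒ : G → Submodule F (Matrix (Fin 2) (Fin 2) F)) : Prop where
  le : ∀ g, ℒ g ≤ slM F 2
  indep : iSupIndep ℒ
  iSup_eq : ⨆ g, ℒ g = slM F 2
  lie_mem : ∀ g h, ∀ x ∈ ℒ g, ∀ y ∈ ℒ h, x * y - y * x ∈ ℒ (g * h)

namespace IsSlTwoGrading

variable {F G : Type*} [Field F] [CommGroup G] {ℒ : G → Submodule F (Matrix (Fin 2) (Fin 2) F)}
  {g h k : G} {x y H : Matrix (Fin 2) (Fin 2) F}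

theorem add_eq_zero (hℒ : IsSlTwoGrading ℒ) (hj : h ≠ g) (hk : k ≠ g) (hx : x ∈ ℒ h)
    (hy : y ∈ ℒ k) (hxy : x + y ∈ ℒ g) : x + y = 0 := by
  refine Submodule.disjoint_def.mp (hℒ.indep g) _ hxy (add_mem ?_ ?_)
  · exact Submodule.mem_iSup_of_mem h (Submodule.mem_iSup_of_mem hj hx)
  · exact Submodule.mem_iSup_of_mem k (Submodule.mem_iSup_of_mem hk hy)

theorem exists_apply_ne_zero (hℒ : IsSlTwoGrading ℒ) {M : Type*} [AddCommGroup M] [Module F M]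
    (φ : Matrix (Fin 2) (Fin 2) F →ₗ[F] M) (hy : y ∈ slM F 2) (hφ : φ y ≠ 0) :
    ∃ g, ∃ x ∈ ℒ g, φ x ≠ 0 := by
  by_contra! h
  rw [← hℒ.iSup_eq] at hy
  exact hφ ((iSup_le fun g x hx => h g x hx : ⨆ g, ℒ g ≤ LinearMap.ker φ) hy)

theorem exists_trace_mul_ne_zero (hℒ : IsSlTwoGrading ℒ) (h2 : (2 : F) ≠ 0) (hx : x ∈ slM F 2)
    (hx0 : x ≠ 0) : ∃ g, ∃ y ∈ ℒ g, (x * y).trace ≠ 0 := by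
  obtain ⟨y, hy, hxy⟩ : ∃ y ∈ slM F 2, (x * y).trace ≠ 0 := by
    by_contra! h
    exact hx0 (eq_zero_of_trace_mul_slM h2 hx h)
  exact hℒ.exists_apply_ne_zero (Matrix.traceLinearMap (Fin 2) F F ∘ₗ LinearMap.mulLeft F x) hy hxy

theorem exists_lie_ne_zero (hℒ : IsSlTwoGrading ℒ) (h2 : (2 : F) ≠ 0) (hx : x ∈ slM F 2)
    (hx0 : x ≠ 0) : ∃ g, ∃ y ∈ ℒ g, x * y - y * x ≠ 0 := by
  obtain ⟨y, hy, hxy⟩ : ∃ y ∈ slM F 2, x * y - y * x ≠ 0 := by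
    by_contra! h
    exact hx0 (eq_zero_of_commute_slM h2 hx h)
  exact hℒ.exists_apply_ne_zero (LinearMap.mulLeft F x - LinearMap.mulRight F x) hy hxy

theorem smul_sub_smul_mem (hℒ : IsSlTwoGrading ℒ) (hx : x ∈ ℒ g) (hy : y ∈ ℒ h) :
    (2 * (x * x).trace) • y - (2 * (x * y).trace) • x ∈ ℒ (g * (g * h)) := by
  rw [← slM_two_lie_lie (hℒ.le g hx) (hℒ.le h hy)]
  exact hℒ.lie_mem _ _ _ hx _ (hℒ.lie_mem _ _ _ hx _ hy)

theorem trace_mul_self_eq_zero (hℒ : IsSlTwoGrading ℒ) (h2 : (2 : F) ≠ 0) (hg : g * g ≠ 1)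
    (hx : x ∈ ℒ g) : (x * x).trace = 0 := by
  by_contra hb
  have key (h) (hh : g ≠ h) (y) (hy : y ∈ ℒ h) : y = 0 := by
    have := hℒ.add_eq_zero (g := h) (by rwa [← mul_assoc, ne_eq, mul_eq_right]) hh
      (hℒ.smul_sub_smul_mem hx hy) ((ℒ g).smul_mem (2 * (x * y).trace) hx)
      (by rw [sub_add_cancel]; exact (ℒ h).smul_mem _ hy)
    rw [sub_add_cancel] at this
    simpa [h2, hb] using this
  have hx0 : x ≠ 0 := by rintro rfl; simp at hb
  obtain ⟨h, y, hy, hxy⟩ := hℒ.exists_lie_ne_zero h2 (hℒ.le g hx) hx0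
  obtain rfl : g = h := by
    by_contra hgh
    simp [key h hgh y hy] at hxy
  refine hxy (key (g * g) ?_ _ (hℒ.lie_mem _ _ _ hx _ hy))
  intro hgg
  exact hg (by rw [← hgg, left_eq_mul.mp hgg])

/-- Homogeneous components of degrees not inverse to each other are orthogonal for the trace
form. -/
theorem trace_mul_eq_zero (hℒ : IsSlTwoGrading ℒ) (h2 : (2 : F) ≠ 0) (hgh : g * h ≠ 1)
    (hx : x ∈ ℒ g) (hy : y ∈ ℒ h) : (x * y).trace = 0 := by
  by_cases hne : h = g
  · subst hne
    have hxy := hℒ.trace_mul_self_eq_zero h2 hgh (add_mem hx hy)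
    rw [add_mul, mul_add, mul_add, Matrix.trace_add, Matrix.trace_add, Matrix.trace_add,
      hℒ.trace_mul_self_eq_zero h2 hgh hx, hℒ.trace_mul_self_eq_zero h2 hgh hy,
      Matrix.trace_mul_comm y x] at hxy
    have : 2 * (x * y).trace = 0 := by linear_combination hxy
    simpa [h2] using this
  · by_contra hb
    have := hℒ.add_eq_zero (g := g) (by rwa [ne_eq, mul_eq_left]) hne
      (neg_mem (hℒ.smul_sub_smul_mem hx hy)) ((ℒ h).smul_mem (2 * (x * x).trace) hy)
      (by rw [neg_sub, sub_add_cancel]; exact (ℒ g).smul_mem _ hx)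
    rw [neg_sub, sub_add_cancel] at this
    obtain rfl : x = 0 := by simpa [h2, hb] using this
    simp at hb

theorem exists_mul_self_eq_one [IsAlgClosed F] (hℒ : IsSlTwoGrading ℒ) (h2 : (2 : F) ≠ 0)
    (h1 : ℒ 1 ≠ ⊥) : ∃ H ∈ ℒ 1, H * H = 1 := by
  obtain ⟨x, hx, hb⟩ : ∃ x ∈ ℒ 1, (x * x).trace ≠ 0 := by
    obtain ⟨x, hx, hx0⟩ := Submodule.exists_mem_ne_zero_of_ne_bot h1
    obtain ⟨g, y, hy, hxy⟩ := hℒ.exists_trace_mul_ne_zero h2 (hℒ.le 1 hx) hx0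
    obtain rfl : g = 1 := by
      by_contra hg
      exact hxy (hℒ.trace_mul_eq_zero h2 (by rwa [one_mul]) hx hy)
    by_contra! h
    have h₁ := h _ (add_mem hx hy)
    rw [add_mul, mul_add, mul_add, Matrix.trace_add, Matrix.trace_add, Matrix.trace_add,
      h x hx, h y hy, Matrix.trace_mul_comm y x] at h₁
    have : 2 * (x * y).trace = 0 := by linear_combination h₁
    simp [h2, hxy] at this
  obtain ⟨c, hc⟩ := IsAlgClosed.exists_pow_nat_eq (2 / (x * x).trace) two_pos
  refine ⟨c • x, (ℒ 1).smul_mem c hx, ?_⟩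
  have hxx := slM_two_mul_add_mul (hℒ.le 1 hx) (hℒ.le 1 hx)
  have h₁ : (2 : F) • ((c • x) * (c • x)) = (2 : F) • 1 := by
    rw [two_smul, smul_mul_smul_comm, ← smul_add, hxx, smul_smul, ← pow_two, hc,
      div_mul_cancel₀ _ hb]
  exact smul_right_injective _ h2 h₁

theorem mul_mul_mem (hℒ : IsSlTwoGrading ℒ) (h2 : (2 : F) ≠ 0) (hH : H ∈ ℒ 1) (hHH : H * H = 1)
    (hy : y ∈ ℒ g) : (1 + H) * y * (1 - H) ∈ ℒ g := by
  have h₁ := slM_two_mul_add_mul (hℒ.le 1 hH) (hℒ.le g hy)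
  have h₃ : (1 + H) * y * (1 - H) = (2 : F) • y + (H * y - y * H) - (H * y).trace • H := by
    have h₄ : H * y * H = (H * y).trace • H - y := by
      have := congrArg (H * ·) h₁
      simp only [mul_add, ← mul_assoc, hHH, one_mul, mul_smul_comm, mul_one] at this
      rw [← this]; abel
    rw [two_smul, add_mul, one_mul, mul_sub, mul_one, add_mul, h₄]
    abel
  rw [h₃]
  refine sub_mem (add_mem ((ℒ g).smul_mem _ hy) ?_) ?_
  · simpa using hℒ.lie_mem 1 g H hH y hy
  · by_cases hg : g = 1
    · subst hg
      exact (ℒ 1).smul_mem _ hH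
    · rw [hℒ.trace_mul_eq_zero h2 (by rwa [one_mul]) hH hy, zero_smul]
      exact zero_mem _

theorem exists_sl2_triple [IsAlgClosed F] (hℒ : IsSlTwoGrading ℒ) (h2 : (2 : F) ≠ 0)
    (h1 : ℒ 1 ≠ ⊥) :
    ∃ (g : G) (E H F' : Matrix (Fin 2) (Fin 2) F),
      H ∈ ℒ 1 ∧ E ∈ ℒ g ∧ F' ∈ ℒ g⁻¹ ∧
      LinearIndependent F ![E, H, F'] ∧
      Submodule.span F {E, H, F'} = slM F 2 ∧
      H * E - E * H = (2 : F) • E ∧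
      H * F' - F' * H = -((2 : F) • F') ∧
      E * F' - F' * E = H := by
  obtain ⟨H, hH, hHH⟩ := hℒ.exists_mul_self_eq_one h2 h1
  have hp : H * (1 + H) = 1 + H := by rw [mul_add, mul_one, hHH, add_comm]
  have hp' : (1 + H) * H = 1 + H := by rw [add_mul, one_mul, hHH, add_comm]
  have hm : H * (1 - H) = -(1 - H) := by rw [mul_sub, mul_one, hHH, neg_sub]
  have hm' : (1 - H) * H = -(1 - H) := by rw [sub_mul, one_mul, hHH, neg_sub]
  obtain ⟨Y, hY, hY0⟩ := exists_mul_mul_ne_zero h2 (hℒ.le 1 hH)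
  obtain ⟨g, y, hy, hE0⟩ := hℒ.exists_apply_ne_zero
    (LinearMap.mulRight F (1 - H) ∘ₗ LinearMap.mulLeft F (1 + H)) hY hY0
  have hE := hℒ.mul_mul_mem h2 hH hHH hy
  change (1 + H) * y * (1 - H) ≠ 0 at hE0
  have hHE : H * ((1 + H) * y * (1 - H)) = (1 + H) * y * (1 - H) := by
    rw [← mul_assoc, ← mul_assoc, hp]
  have hEH : (1 + H) * y * (1 - H) * H = -((1 + H) * y * (1 - H)) := by
    rw [mul_assoc, hm', mul_neg]
  generalize (1 + H) * y * (1 - H) = E at *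
  obtain ⟨h, z, hz, hEz⟩ := hℒ.exists_trace_mul_ne_zero h2 (hℒ.le g hE) hE0
  obtain rfl : h = g⁻¹ := by
    by_contra hne
    exact hEz (hℒ.trace_mul_eq_zero h2 (by rwa [ne_eq, mul_eq_one_iff_inv_eq, eq_comm]) hE hz)
  have hF := hℒ.mul_mul_mem h2 (neg_mem hH) (by rw [neg_mul_neg, hHH]) hz
  rw [← sub_eq_add_neg, sub_neg_eq_add] at hF
  have hHF : H * ((1 - H) * z * (1 + H)) = -((1 - H) * z * (1 + H)) := by
    rw [← mul_assoc, ← mul_assoc, hm, neg_mul, neg_mul]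
  have hFH : (1 - H) * z * (1 + H) * H = (1 - H) * z * (1 + H) := by
    rw [mul_assoc, hp']
  have hEF : (E * ((1 - H) * z * (1 + H))).trace = 2 * (2 * (E * z).trace) := by
    have h₁ : E * (1 - H) = (2 : F) • E := by
      rw [mul_sub, hEH, mul_one, sub_neg_eq_add, two_smul]
    have h₃ : (1 + H) * E = (2 : F) • E := by
      rw [add_mul, hHE, one_mul, two_smul]
    rw [← mul_assoc, ← mul_assoc, h₁, Matrix.trace_mul_comm, smul_mul_assoc, mul_smul_comm,
      ← mul_assoc, h₃, smul_mul_assoc, Matrix.trace_smul, Matrix.trace_smul, smul_eq_mul,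
      smul_eq_mul]
  generalize (1 - H) * z * (1 + H) = F' at *
  have hEF0 : (E * F').trace ≠ 0 := by simp [hEF, h2, hEz]
  have hF' := (ℒ g⁻¹).smul_mem (E * F').trace⁻¹ hF
  exact ⟨g, E, H, (E * F').trace⁻¹ • F', hH, hE, hF',
    sl2_triple_of_eigenvectors h2 (hℒ.le _ hE) (hℒ.le _ hH) (hℒ.le _ hF') hHH hHE hEH
      (by rw [mul_smul_comm, hHF, smul_neg]) (by rw [smul_mul_assoc, hFH])
      (by rw [mul_smul_comm, Matrix.trace_smul, smul_eq_mul, inv_mul_cancel₀ hEF0])⟩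

theorem mul_self_eq_one_of_one_eq_bot (hℒ : IsSlTwoGrading ℒ) (h2 : (2 : F) ≠ 0) (h1 : ℒ 1 = ⊥)
    (hx : x ∈ ℒ g) (hx0 : x ≠ 0) : g * g = 1 ∧ (x * x).trace ≠ 0 := by
  have hb : (x * x).trace ≠ 0 := by
    intro hb
    obtain ⟨h, y, hy, hxy⟩ := hℒ.exists_trace_mul_ne_zero h2 (hℒ.le g hx) hx0
    have hgh : g * h = 1 := by
      by_contra hgh
      exact hxy (hℒ.trace_mul_eq_zero h2 hgh hx hy)
    have hlie := hℒ.lie_mem _ _ _ hx _ hy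
    rw [hgh, h1, Submodule.mem_bot] at hlie
    have := slM_two_lie_lie (hℒ.le g hx) (hℒ.le h hy)
    rw [hlie] at this
    simp [hb, h2, hxy, hx0] at this
  exact ⟨by_contra fun hg => hb (hℒ.trace_mul_self_eq_zero h2 hg hx), hb⟩

theorem finrank_eq_one_of_one_eq_bot (hℒ : IsSlTwoGrading ℒ) (h2 : (2 : F) ≠ 0) (h1 : ℒ 1 = ⊥)
    (hg : ℒ g ≠ ⊥) : Module.finrank F (ℒ g) = 1 := by
  obtain ⟨x, hx, hx0⟩ := Submodule.exists_mem_ne_zero_of_ne_bot hg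
  obtain ⟨hgg, hb⟩ := hℒ.mul_self_eq_one_of_one_eq_bot h2 h1 hx hx0
  refine finrank_eq_one ⟨x, hx⟩ (by simpa using hx0) fun ⟨y, hy⟩ =>
    ⟨(x * x).trace⁻¹ * (x * y).trace, Subtype.ext ?_⟩
  have hlie := hℒ.lie_mem _ _ _ hx _ hy
  rw [hgg, h1, Submodule.mem_bot] at hlie
  have := slM_two_lie_lie (hℒ.le g hx) (hℒ.le g hy)
  rw [hlie, mul_zero, zero_mul, sub_zero, mul_smul, mul_smul, ← smul_sub, eq_comm,
    smul_eq_zero_iff_right h2, sub_eq_zero] at this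
  change ((x * x).trace⁻¹ * (x * y).trace) • x = y
  rw [mul_smul, ← this, inv_smul_smul₀ hb]

theorem exists_support_of_one_eq_bot (hℒ : IsSlTwoGrading ℒ) (h2 : (2 : F) ≠ 0) (h1 : ℒ 1 = ⊥) :
    ∃ g h : G, g * g = 1 ∧ h * h = 1 ∧ g ≠ h ∧ g ≠ 1 ∧ h ≠ 1 ∧
      ∀ k, ℒ k ≠ ⊥ ↔ k = g ∨ k = h ∨ k = g * h := by
  have hne1 {k : G} {x} (hx : x ∈ ℒ k) (hx0 : x ≠ 0) : k ≠ 1 := by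
    rintro rfl
    rw [h1, Submodule.mem_bot] at hx
    exact hx0 hx
  have hne {k : G} {x} (hx : x ∈ ℒ k) (hx0 : x ≠ 0) : ℒ k ≠ ⊥ :=
    (Submodule.ne_bot_iff _).mpr ⟨x, hx, hx0⟩
  obtain ⟨g, x, hx, hx0⟩ := hℒ.exists_apply_ne_zero LinearMap.id
    single_zero_one_mem_slM (fun h => by simpa using congrFun (congrFun h 0) 1)
  change x ≠ 0 at hx0
  obtain ⟨h, y, hy, hz0⟩ := hℒ.exists_lie_ne_zero h2 (hℒ.le g hx) hx0
  have hy0 : y ≠ 0 := by rintro rfl; simp at hz0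
  have hz := hℒ.lie_mem _ _ _ hx _ hy
  obtain ⟨hg, -⟩ := hℒ.mul_self_eq_one_of_one_eq_bot h2 h1 hx hx0
  obtain ⟨hh, -⟩ := hℒ.mul_self_eq_one_of_one_eq_bot h2 h1 hy hy0
  obtain ⟨hgh, hb⟩ := hℒ.mul_self_eq_one_of_one_eq_bot h2 h1 hz hz0
  have hgh1 := hne1 hz hz0
  refine ⟨g, h, hg, hh, ?_, hne1 hx hx0, hne1 hy hy0, fun k => ⟨fun hk => ?_, ?_⟩⟩
  · rintro rfl
    exact hgh1 hg
  · by_contra! hk'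
    obtain ⟨w, hw, hw0⟩ := Submodule.exists_mem_ne_zero_of_ne_bot hk
    have anti {l : G} {v} (hl : l * l = 1) (hkl : k ≠ l) (hv : v ∈ ℒ l) : w * v = -(v * w) := by
      have h₁ := slM_two_mul_add_mul (hℒ.le k hw) (hℒ.le l hv)
      rw [hℒ.trace_mul_eq_zero h2 (fun hkl' => hkl ?_) hw hv, zero_smul] at h₁
      · exact eq_neg_of_add_eq_zero_left h₁
      · rw [← mul_one k, ← hl, ← mul_assoc, hkl', one_mul]
    have hwx := anti hg hk'.1 hx
    have hwy := anti hh hk'.2.1 hy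
    have hwz := anti hgh hk'.2.2 hz
    have hcomm : w * (x * y - y * x) = (x * y - y * x) * w := by
      rw [mul_sub, ← mul_assoc, ← mul_assoc, hwx, hwy, neg_mul, neg_mul, mul_assoc, mul_assoc,
        hwx, hwy, mul_neg, mul_neg, neg_neg, neg_neg, sub_mul, mul_assoc, mul_assoc]
    generalize x * y - y * x = z at *
    have hzw : z * w = 0 := by
      have : (2 : F) • (z * w) = 0 := by
        rw [two_smul]
        nth_rw 1 [← hcomm]
        rw [hwz, neg_add_cancel]
      exact (smul_eq_zero_iff_right h2).mp this
    have hzz := congrArg (· * w) (slM_two_mul_add_mul (hℒ.le _ hz) (hℒ.le _ hz))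
    simp [add_mul, mul_assoc, hzw, hb, hw0, eq_comm] at hzz
  · rintro (rfl | rfl | rfl)
    exacts [hne hx hx0, hne hy hy0, hne hz hz0]

end IsSlTwoGrading

/-- Every `G`-grading of `sl₂(F)` (`char F ≠ 2`) is either induced from
a Cartan decomposition (by an element `g ∈ G`) or is a Pauli grading with support the
three nontrivial elements of a subgroup `T ≅ ℤ/2 × ℤ/2`, and exactly one of these
two cases occurs. -/
theorem sl2_grading_dichotomy
    {F : Type*} [Field F] [IsAlgClosed F] (hchar : ringChar F ≠ 2)
    {G : Type*} [CommGroup G]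
    (ℒ : G → Submodule F (Matrix (Fin 2) (Fin 2) F))
    (hsub : ∀ g : G, ℒ g ≤ slM F 2)
    (hind : iSupIndep ℒ)
    (hsup : (⨆ g : G, ℒ g) = slM F 2)
    (hbr : ∀ g h : G, ∀ x ∈ ℒ g, ∀ y ∈ ℒ h, x * y - y * x ∈ ℒ (g * h)) :
    Xor'
      -- (i) grading induced from a Cartan decomposition
      (∃ (g : G) (E H F' : Matrix (Fin 2) (Fin 2) F),
        H ∈ ℒ 1 ∧ E ∈ ℒ g ∧ F' ∈ ℒ g⁻¹ ∧
        LinearIndependent F ![E, H, F'] ∧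
        Submodule.span F {E, H, F'} = slM F 2 ∧
        H * E - E * H = (2 : F) • E ∧
        H * F' - F' * H = -((2 : F) • F') ∧
        E * F' - F' * E = H)
      -- (ii) Pauli grading
      (∃ T : Subgroup G,
        Nonempty (T ≃* Multiplicative (ZMod 2) × Multiplicative (ZMod 2)) ∧
        (∀ g : G, ℒ g ≠ ⊥ ↔ (g ∈ T ∧ g ≠ 1)) ∧
        (∀ g : G, g ∈ T → g ≠ 1 → Module.finrank F (ℒ g) = 1)) := by
  have h2 : (2 : F) ≠ 0 := Ring.two_ne_zero hchar
  have hℒ : IsSlTwoGrading ℒ := ⟨hsub, hind, hsup, hbr⟩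
  by_cases h1 : ℒ 1 = ⊥
  · refine Or.inr ⟨?_, ?_⟩
    · obtain ⟨g, h, hg, hh, hgh, hg1, hh1, hsupp⟩ := hℒ.exists_support_of_one_eq_bot h2 h1
      obtain ⟨T, hT, hmem⟩ := Subgroup.exists_isKleinFour hg hh hg1 hh1 hgh
      have hT' (k : G) : ℒ k ≠ ⊥ ↔ k ∈ T ∧ k ≠ 1 := by
        refine ⟨fun hk => ⟨(hmem k).mpr (Or.inr ((hsupp k).mp hk)), ?_⟩, fun hk =>
          (hsupp k).mpr (((hmem k).mp hk.1).resolve_left hk.2)⟩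
        rintro rfl
        exact hk h1
      have : IsKleinFour (Multiplicative (ZMod 2) × Multiplicative (ZMod 2)) :=
        ⟨by simp, by simp [Monoid.exponent_prod]⟩
      exact ⟨T, IsKleinFour.nonempty_mulEquiv, hT',
        fun k hk hk1 => hℒ.finrank_eq_one_of_one_eq_bot h2 h1 ((hT' k).mpr ⟨hk, hk1⟩)⟩
    · rintro ⟨g, E, H, F', hH, -, -, hli, -⟩
      rw [h1, Submodule.mem_bot] at hH
      exact hli.ne_zero 1 hH
  · exact Or.inl ⟨hℒ.exists_sl2_triple h2 h1, fun ⟨T, _, hT, _⟩ => ((hT 1).mp h1).2 rfl⟩
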